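/- Let P be a lower triangular 3×3 matrix in SU(2,1;ℤ[i]). Then there exist a complex number β with β⁴ = 1, a Gaussian integer γ whose norm |γ|² is an even integer, and an integer r, such that P equals the matrix with rows (β, 0, 0), (βγ, β⁻², 0), (β(½|γ|² + i r), conj(γ)·β⁻², β). -/

import Mathlib

open Matrix Complex

/-- The matrix `C` of the quadratic form defining the Siegel domain. -/
noncomputable def Cmat : Matrix (Fin 3) (Fin 3) ℂ := !![0,0,-1; 0,1,0; -1,0,0]

/-- Membership in `SU(2,1)`: `Gᴴ C G = C` and `det G = 1`. -/
def inSU21 (G : Matrix (Fin 3) (Fin 3) ℂ) : Prop :=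
  G.conjTranspose * Cmat * G = Cmat ∧ G.det = 1

/-- A complex number is a Gaussian integer. -/
def IsGaussianInt (z : ℂ) : Prop := ∃ m n : ℤ, z = (m : ℂ) + (n : ℂ) * Complex.I

/-- The Heisenberg translation matrix `N_a` for `a = (a₁, a₂) ∈ ℂ²`. -/
noncomputable def N (a : ℂ × ℂ) : Matrix (Fin 3) (Fin 3) ℂ :=
  !![1, 0, 0; a.1, 1, 0; a.2, star a.1, 1]

/-- The rotation matrix `M_i = diag(i, -1, i)`. -/
noncomputable def Mi : Matrix (Fin 3) (Fin 3) ℂ :=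
  !![Complex.I, 0, 0; 0, -1, 0; 0, 0, Complex.I]

/-- The involution `J`. -/
noncomputable def Jmat : Matrix (Fin 3) (Fin 3) ℂ := !![0, 0, -1; 0, -1, 0; -1, 0, 0]

/-- `N_{(0,i)}` as an element of `SL(3,ℂ)`. -/
noncomputable def N0i : Matrix.SpecialLinearGroup (Fin 3) ℂ :=
  ⟨N (0, Complex.I), by simp [N, Matrix.det_fin_three]⟩

/-- `N_{(1+i,1)}` as an element of `SL(3,ℂ)`. -/
noncomputable def N1 : Matrix.SpecialLinearGroup (Fin 3) ℂ :=
  ⟨N (1 + Complex.I, 1), by simp [N, Matrix.det_fin_three]⟩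

/-- `M_i` as an element of `SL(3,ℂ)`. -/
noncomputable def MiSL : Matrix.SpecialLinearGroup (Fin 3) ℂ :=
  ⟨Mi, by simp [Mi, Matrix.det_fin_three]⟩

/-- `J` as an element of `SL(3,ℂ)`. -/
noncomputable def JSL : Matrix.SpecialLinearGroup (Fin 3) ℂ :=
  ⟨Jmat, by simp [Jmat, Matrix.det_fin_three]⟩

/-- `N_{(0,i)}` as an invertible matrix. -/
noncomputable def N0iGL : GL (Fin 3) ℂ := N0i.toGL
/-- `N_{(1+i,1)}` as an invertible matrix. -/
noncomputable def N1GL : GL (Fin 3) ℂ := N1.toGL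
/-- `M_i` as an invertible matrix. -/
noncomputable def MiGL : GL (Fin 3) ℂ := MiSL.toGL
/-- `J` as an invertible matrix. -/
noncomputable def JGL : GL (Fin 3) ℂ := JSL.toGL

theorem IsGaussianInt.mul {z w : ℂ} (hz : IsGaussianInt z) (hw : IsGaussianInt w) :
    IsGaussianInt (z * w) := by
  obtain ⟨m, n, rfl⟩ := hz
  obtain ⟨p, q, rfl⟩ := hw
  refine ⟨m * p - n * q, m * q + n * p, ?_⟩
  push_cast
  linear_combination (n * q : ℂ) * Complex.I_sq

theorem IsGaussianInt.conj {z : ℂ} (hz : IsGaussianInt z) : IsGaussianInt (star z) := by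
  obtain ⟨m, n, rfl⟩ := hz
  exact ⟨m, -n, by simp⟩

/-- A Gaussian integer whose conjugate is invertible in `ℤ[i]` is a fourth root of unity. -/
theorem IsGaussianInt.pow_four_eq_one {z w : ℂ} (hz : IsGaussianInt z) (hw : IsGaussianInt w)
    (h : star z * w = 1) : z ^ 4 = 1 := by
  obtain ⟨m, n, rfl⟩ := hz
  obtain ⟨p, q, rfl⟩ := hw
  have hre := congrArg Complex.re h
  have him := congrArg Complex.im h
  simp at hre him
  norm_cast at hre him
  have hprod : (m ^ 2 + n ^ 2) * (p ^ 2 + q ^ 2) = 1 := by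
    linear_combination (m * p + n * q + 1) * hre + (m * q - n * p) * him
  have hmn : m ^ 2 + n ^ 2 = 1 := Int.eq_one_of_mul_eq_one_right (by positivity) hprod
  have hm : -1 ≤ m ∧ m ≤ 1 := abs_le.mp (abs_le_one_iff_mul_self_le_one.mpr (by nlinarith))
  have hn : -1 ≤ n ∧ n ≤ 1 := abs_le.mp (abs_le_one_iff_mul_self_le_one.mpr (by nlinarith))
  obtain ⟨hm₁, hm₂⟩ := hm
  obtain ⟨hn₁, hn₂⟩ := hn
  interval_cases m <;> interval_cases n <;> simp_all [Even.neg_pow (show Even 4 by decide)]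

/-- Langlands parameters of a lower triangular element of `SU(2,1;ℤ[i])`: no dilation
component, `β⁴ = 1`, `γ` a Gaussian integer of even norm and `r ∈ ℤ`. -/
theorem langlands_parameters_integral (P : Matrix (Fin 3) (Fin 3) ℂ)
    (hP : inSU21 P) (hZ : ∀ j k, IsGaussianInt (P j k))
    (hlt : P 0 1 = 0 ∧ P 0 2 = 0 ∧ P 1 2 = 0) :
    ∃ (β γ : ℂ) (r : ℤ), β ^ 4 = 1 ∧ IsGaussianInt γ ∧
      (∃ t : ℤ, γ * star γ = 2 * (t : ℂ)) ∧
      P = !![β, 0, 0;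
             β * γ, β⁻¹ ^ 2, 0;
             β * (γ * star γ / 2 + (r : ℂ) * Complex.I), star γ * β⁻¹ ^ 2, β] := by
  obtain ⟨hC, hdet⟩ := hP
  obtain ⟨h01, h02, h12⟩ := hlt
  have entry (j k : Fin 3) := congrFun (congrFun hC j) k
  have e00 := entry 0 0
  have e01 := entry 0 1
  have e02 := entry 0 2
  simp [Matrix.mul_apply, Fin.sum_univ_three, Cmat, h01, h02, h12] at e00 e01 e02
  rw [Matrix.det_fin_three] at hdet
  simp only [h01, h02, h12, mul_zero, zero_mul, sub_zero, add_zero] at hdet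
  have ha4 : P 0 0 ^ 4 = 1 :=
    IsGaussianInt.pow_four_eq_one (hZ 0 0) (hZ 2 2) (by simpa using e02)
  have hnorm : (starRingEnd ℂ) (P 0 0) * P 0 0 = 1 := by
    rw [Complex.conj_mul', Complex.norm_eq_one_of_pow_eq_one ha4 (by norm_num)]
    simp
  have hinv : (P 0 0)⁻¹ = (starRingEnd ℂ) (P 0 0) := inv_eq_of_mul_eq_one_left hnorm
  have h22 : P 2 2 = P 0 0 := by linear_combination P 0 0 * e02 - P 2 2 * hnorm
  rw [h22] at hdet
  have h11 : P 1 1 = (starRingEnd ℂ) (P 0 0) ^ 2 := by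
    linear_combination (starRingEnd ℂ) (P 0 0) ^ 2 * hdet
      - P 1 1 * ((starRingEnd ℂ) (P 0 0) * P 0 0 + 1) * hnorm
  obtain ⟨t, r, htr⟩ := IsGaussianInt.mul (hZ 2 0) (IsGaussianInt.conj (hZ 0 0))
  have htr' := congrArg (starRingEnd ℂ) htr
  simp at htr htr'
  have hγ : P 1 0 * star (P 0 0) * star (P 1 0 * star (P 0 0)) = 2 * (t : ℂ) := by
    simp
    linear_combination P 1 0 * (starRingEnd ℂ) (P 1 0) * hnorm + e00 + htr + htr'
  refine ⟨P 0 0, P 1 0 * star (P 0 0), r, ha4,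
    IsGaussianInt.mul (hZ 1 0) (IsGaussianInt.conj (hZ 0 0)), ⟨t, hγ⟩, ?_⟩
  rw [hγ, hinv]
  ext j k
  fin_cases j <;> fin_cases k <;> simp [h01, h02, h12, h11, h22]
  · linear_combination -P 1 0 * hnorm
  · linear_combination P 0 0 * htr - P 2 0 * hnorm
  · linear_combination -P 0 0 * e01 - P 2 1 * hnorm + P 0 0 * (starRingEnd ℂ) (P 1 0) * h11
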